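/- arXiv:2303.02793 — 2 statements merged into one kernel-verified Lean document; each statement's English description precedes it below -/
import Mathlib

section
/- For every integer n ≥ 2, a(n) = e(n) · o(n), where (with the convention that binomial coefficients C(m,r) vanish when r < 0 or r > m) e(n) = 2^{n−2} + 2·∑_{k=0}^{⌊(n+1)/2⌋} ∑_{ℓ=k+1}^{⌊(n+1)/2⌋} ( C(n−1, n−k−ℓ) − C(n−1, n+k−ℓ+1) ) and o(n) = 2^{n−2} + 2·∑_{k=0}^{⌊n/2⌋} ∑_{ℓ=k+1}^{⌊n/2⌋} ( C(n−1, n−k−ℓ−1) − C(n−1, n+k−ℓ+1) ). -/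
/-- `a188818 n` is the number of `n × n` binary arrays without the pattern `01`
diagonally or antidiagonally (OEIS A188818). -/
noncomputable def a188818 (n : ℕ) : ℕ :=
  Nat.card {A : Fin n × Fin n → Fin 2 //
    ∀ p q : Fin n × Fin n, (q.1 : ℕ) = (p.1 : ℕ) + 1 →
      ((q.2 : ℕ) = (p.2 : ℕ) + 1 ∨ (p.2 : ℕ) = (q.2 : ℕ) + 1) →
      ¬(A p = 0 ∧ A q = 1)}

/-- The binomial coefficient `C(m,r)` for integers, with the convention that it
vanishes when `r < 0` or `r > m`. -/
def ich (m r : ℤ) : ℤ :=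
  if 0 ≤ r ∧ r ≤ m then (m.toNat.choose r.toNat : ℤ) else 0

/-- The number of `±1` walks of length `m` on `ℤ` with displacement `d`. -/
def walkCount : ℕ → ℤ → ℤ
  | 0, d => if d = 0 then 1 else 0
  | m + 1, d => walkCount m (d - 1) + walkCount m (d + 1)

theorem walkCount_eq_zero (m : ℕ) (d : ℤ) (h : (m : ℤ) < d ∨ d < -(m : ℤ)) :
    walkCount m d = 0 := by
  induction m generalizing d with
  | zero => simp only [walkCount]; rw [if_neg]; push_cast at h; omega
  | succ m ih =>
    push_cast at h
    simp only [walkCount]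
    rw [ih _ (by omega), ih _ (by omega), add_zero]

theorem walkCount_neg (m : ℕ) (d : ℤ) : walkCount m (-d) = walkCount m d := by
  induction m generalizing d with
  | zero => simp [walkCount]
  | succ m ih =>
    simp only [walkCount]
    rw [← ih (d - 1), ← ih (d + 1), add_comm]
    congr 2 <;> ring

theorem ich_natCast_zero (x : ℤ) : ich ((0 : ℕ) : ℤ) x = if x = 0 then 1 else 0 := by
  unfold ich
  by_cases h : x = 0
  · subst h; simp
  · rw [if_neg (by push_cast; omega), if_neg h]

theorem ich_eq_zero {m r : ℤ} (h : r < 0 ∨ m < r) : ich m r = 0 := by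
  unfold ich
  rw [if_neg (by omega)]

theorem ich_natCast_natCast (m r : ℕ) : ich m r = m.choose r := by
  unfold ich
  split_ifs with h
  · simp
  · rw [Nat.choose_eq_zero_of_lt (by omega)]; simp

theorem ich_succ (m : ℕ) (x : ℤ) :
    ich ((m + 1 : ℕ) : ℤ) x = ich m x + ich m (x - 1) := by
  rcases lt_or_ge x 0 with h | h
  · rw [ich_eq_zero (by omega), ich_eq_zero (by omega), ich_eq_zero (by omega), add_zero]
  · obtain ⟨x, rfl⟩ := Int.eq_ofNat_of_zero_le h
    cases x with
    | zero =>
      rw [ich_natCast_natCast, ich_natCast_natCast, ich_eq_zero (by omega)]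
      simp
    | succ x =>
      have : (((x + 1 : ℕ) : ℤ) - 1) = (x : ℤ) := by push_cast; ring
      rw [this, ich_natCast_natCast, ich_natCast_natCast, ich_natCast_natCast,
        Nat.choose_succ_succ]
      push_cast; ring

theorem walkCount_two_mul_sub (m : ℕ) (u : ℤ) : walkCount m (2 * u - m) = ich m u := by
  induction m generalizing u with
  | zero =>
    simp only [walkCount, ich_natCast_zero]
    exact if_congr (by push_cast; omega) rfl rfl
  | succ m ih =>
    rw [ich_succ, ← ih, ← ih, walkCount, add_comm]
    push_cast
    ring_nf

/-- The number of walks of length `m` on the integer interval `[0, N]` starting at `s`. -/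
def stripCount (N : ℤ) : ℕ → ℤ → ℕ
  | 0, s => if 0 ≤ s ∧ s ≤ N then 1 else 0
  | m + 1, s => if 0 ≤ s ∧ s ≤ N then stripCount N m (s - 1) + stripCount N m (s + 1) else 0

/-- The reflection principle: a walk of length at most `N + 2` on `[0, N]` cannot have met both
barriers, so a single reflection at each of them suffices. -/
theorem stripCount_eq_sum (N p : ℤ) (E : Finset ℤ)
    (hE : ∀ x, x ∈ E ↔ 0 ≤ x ∧ x ≤ N ∧ (x - p) % 2 = 0) (m : ℕ) (hm : (m : ℤ) ≤ N + 2)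
    (s : ℤ) (hs : -1 ≤ s) (hs' : s ≤ N + 1) (hp : (s + m - p) % 2 = 0) :
    (stripCount N m s : ℤ) = ∑ e ∈ E, (walkCount m (e - s) - walkCount m (e + s + 2) -
      walkCount m (2 * (N + 1) - e - s)) := by
  have hbarrier : ∀ m : ℕ, (m : ℤ) ≤ N + 2 → ∀ s, s = -1 ∨ s = N + 1 →
      (stripCount N m s : ℤ) = ∑ e ∈ E, (walkCount m (e - s) - walkCount m (e + s + 2) -
        walkCount m (2 * (N + 1) - e - s)) := by
    intro m hm s hs
    have h0 : stripCount N m s = 0 := by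
      cases m <;> simp only [stripCount] <;> rw [if_neg (by omega)]
    rw [h0, Finset.sum_eq_zero, Nat.cast_zero]
    intro e he
    have := (hE e).1 he
    rcases hs with rfl | rfl
    · rw [walkCount_eq_zero m (2 * (N + 1) - e - -1) (by omega)]
      ring_nf
    · rw [walkCount_eq_zero m (e + (N + 1) + 2) (by omega), ← walkCount_neg m (e - (N + 1))]
      ring_nf
  induction m generalizing s with
  | zero =>
    by_cases hb : s = -1 ∨ s = N + 1
    · exact hbarrier _ hm s hb
    simp only [stripCount, walkCount]
    rw [if_pos (by omega), Finset.sum_eq_single s]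
    · rw [if_pos (by omega), if_neg (by omega), if_neg (by omega)]; simp
    · intro e he hne
      have := (hE e).1 he
      rw [if_neg (by omega), if_neg (by omega), if_neg (by omega)]; simp
    · intro h
      refine absurd ((hE s).2 ?_) h
      push_cast at hp
      exact ⟨by omega, by omega, by omega⟩
  | succ m ih =>
    by_cases hb : s = -1 ∨ s = N + 1
    · exact hbarrier _ hm s hb
    push_cast at hm hp
    simp only [stripCount, walkCount]
    rw [if_pos (by omega)]
    push_cast
    rw [ih (by omega) _ (by omega) (by omega) (by omega),
      ih (by omega) _ (by omega) (by omega) (by omega), ← Finset.sum_add_distrib]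
    refine Finset.sum_congr rfl fun e _ => ?_
    ring_nf

theorem sum_range_ich (p M : ℕ) (q : ℤ) (hq : (p : ℤ) ≤ q) (hM : q < M) :
    ∑ j ∈ Finset.range M, ich p (q - j) = 2 ^ p := by
  induction p generalizing q with
  | zero =>
    obtain ⟨q, rfl⟩ := Int.eq_ofNat_of_zero_le (by simpa using hq)
    rw [Finset.sum_eq_single q]
    · simpa using ich_natCast_zero 0
    · intro j _ hj
      rw [ich_natCast_zero, if_neg (by omega)]
    · intro h
      simp at h; omega
  | succ p ih =>
    push_cast at hq
    have h2 := ih (q - 1) (by omega) (by omega)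
    simp only [ich_succ, Finset.sum_add_distrib]
    rw [ih q (by omega) hM, pow_succ, mul_two, ← h2]
    congr 1
    exact Finset.sum_congr rfl fun j _ => by ring_nf

theorem sum_range_ich_two_mul (p K : ℕ) (q : ℤ) (hq : (p : ℤ) ≤ q) (hK : q < 2 * K) :
    ∑ k ∈ Finset.range K, ich ((p + 1 : ℕ) : ℤ) (q - 2 * k) = 2 ^ p := by
  rw [← sum_range_ich p (2 * K) q hq (by push_cast; omega)]
  clear hK
  induction K with
  | zero => simp
  | succ K ih =>
    rw [Finset.sum_range_succ, ih, ich_succ, mul_add, mul_one, Finset.sum_range_succ,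
      Finset.sum_range_succ]
    push_cast
    rw [add_assoc, sub_sub]

theorem sum_range_sum_range_of_symm (f : ℕ → ℕ → ℤ) (hf : ∀ k l, f k l = f l k) (M : ℕ) :
    ∑ k ∈ Finset.range M, ∑ l ∈ Finset.range M, f k l =
      ∑ k ∈ Finset.range M, f k k +
        2 * ∑ k ∈ Finset.range M, ∑ l ∈ Finset.Ico (k + 1) M, f k l := by
  induction M with
  | zero => simp
  | succ M ih =>
    have h1 : ∑ k ∈ Finset.range M, ∑ l ∈ Finset.Ico (k + 1) (M + 1), f k l =
        ∑ k ∈ Finset.range M, ∑ l ∈ Finset.Ico (k + 1) M, f k l +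
          ∑ k ∈ Finset.range M, f k M := by
      rw [← Finset.sum_add_distrib]
      refine Finset.sum_congr rfl fun k hk => ?_
      rw [Finset.sum_Ico_succ_top (by simpa using hk)]
    simp only [Finset.sum_range_succ, Finset.sum_add_distrib, ih, h1, Finset.Ico_self,
      Finset.sum_empty]
    rw [Finset.sum_congr rfl fun l _ => hf M l]
    ring

/-- The number of walks of length `n - 1` on `[0, n + 1]` whose starting point has parity `r`. -/
theorem sum_stripCount (n r : ℕ) (hn : 2 ≤ n) (hr : r < 2) :
    ((∑ k ∈ Finset.range ((n + 1 - r) / 2 + 1),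
        stripCount (n + 1) (n - 1) (2 * k + r) : ℕ) : ℤ) =
      (2 : ℤ) ^ (n - 2) + 2 * ∑ k ∈ Finset.range ((n + 1 - r) / 2 + 1),
          ∑ l ∈ Finset.Icc (k + 1) ((n + 1 - r) / 2),
            (ich ((n : ℤ) - 1) ((n : ℤ) - (k : ℤ) - (l : ℤ) - r) -
             ich ((n : ℤ) - 1) ((n : ℤ) + (k : ℤ) - (l : ℤ) + 1)) := by
  obtain ⟨n, rfl⟩ := Nat.exists_eq_add_of_le' hn
  set K := (n + 2 + 1 - r) / 2 with hK
  have hKr : 2 * K + r ≤ n + 3 ∧ n + 2 ≤ 2 * K + r := by omega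
  clear_value K
  simp only [Nat.add_sub_cancel, show n + 2 - 1 = n + 1 by omega]
  have hcast : (((n + 2 : ℕ) : ℤ) - 1) = ((n + 1 : ℕ) : ℤ) := by push_cast; ring
  rw [hcast]
  rw [Nat.cast_sum]
  let f : ℕ → ℕ → ℤ := fun k l => ich ((n + 1 : ℕ) : ℤ) ((n + 2 : ℕ) - (k : ℤ) - l - r) -
    ich ((n + 1 : ℕ) : ℤ) ((n + 2 : ℕ) + (k : ℤ) - l + 1) -
    ich ((n + 1 : ℕ) : ℤ) ((n + 2 : ℕ) + (l : ℤ) - k + 1)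
  have hcount : ∀ k ∈ Finset.range (K + 1),
      (stripCount ((n + 2 : ℕ) + 1) (n + 1) (2 * k + r) : ℤ) =
        ∑ l ∈ Finset.range (K + 1), f k l := by
    intro k hk
    rw [Finset.mem_range] at hk
    rw [stripCount_eq_sum ((n + 2 : ℕ) + 1) ((n + 3 : ℕ) - (r : ℤ))
      ((Finset.range (K + 1)).image fun l : ℕ => ((n + 3 : ℕ) - (r : ℤ) - 2 * l)) _ _
      (by push_cast; omega) _ (by omega) (by push_cast; omega) (by push_cast; omega),
      Finset.sum_image]
    · refine Finset.sum_congr rfl fun l _ => ?_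
      simp only [f, ← walkCount_two_mul_sub]
      push_cast
      ring_nf
    · intro a _ b _ h
      simp only at h
      omega
    · intro x
      simp only [Finset.mem_image, Finset.mem_range]
      push_cast
      constructor
      · rintro ⟨l, hl, rfl⟩
        refine ⟨by omega, by omega, by omega⟩
      · rintro ⟨h1, h2, h3⟩
        exact ⟨((n + 3 - r - x) / 2).toNat, by omega, by omega⟩
  rw [Finset.sum_congr rfl hcount, sum_range_sum_range_of_symm f]
  · congr 1
    · rw [← sum_range_ich_two_mul n (K + 1) ((n + 2 : ℕ) - (r : ℤ)) (by push_cast; omega)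
        (by push_cast; omega)]
      refine Finset.sum_congr rfl fun k _ => ?_
      simp only [f]
      rw [ich_eq_zero (r := (n + 2 : ℕ) + (k : ℤ) - k + 1) (by push_cast; omega)]
      simp only [sub_zero]
      congr 1
      ring
    · congr 1
      refine Finset.sum_congr rfl fun k _ => Finset.sum_congr rfl fun l hl => ?_
      have hkl := Finset.mem_Icc.1 hl
      simp only [f]
      rw [ich_eq_zero (r := (n + 2 : ℕ) + (l : ℤ) - k + 1) (by push_cast; omega), sub_zero]
  · intro k l
    simp only [f]
    ring_nf

/-- The walks of length `m` on the integer interval `[0, N]`. -/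
def stripWalks (N : ℤ) (m : ℕ) : Set (Fin (m + 1) → ℤ) :=
  {t | (∀ i, 0 ≤ t i ∧ t i ≤ N) ∧
    ∀ i : Fin m, t i.succ = t i.castSucc + 1 ∨ t i.succ = t i.castSucc - 1}

theorem encard_stripWalks_start (N : ℤ) (m : ℕ) (s : ℤ) :
    {t ∈ stripWalks N m | t 0 = s}.encard = stripCount N m s := by
  have hout : ∀ m : ℕ, ∀ s, ¬(0 ≤ s ∧ s ≤ N) →
      {t ∈ stripWalks N m | t 0 = s}.encard = stripCount N m s := by
    intro m s hs
    have : {t ∈ stripWalks N m | t 0 = s} = ∅ := by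
      ext t
      simp only [Set.mem_ofPred_eq, Set.mem_empty_iff_false, iff_false, not_and]
      rintro ht rfl
      exact hs (ht.1 0)
    rw [this]
    cases m <;> simp [stripCount, hs]
  induction m generalizing s with
  | zero =>
    by_cases hs : 0 ≤ s ∧ s ≤ N
    swap
    · exact hout _ s hs
    have : {t ∈ stripWalks N 0 | t 0 = s} = {fun _ => s} := by
      ext t
      simp only [Set.mem_ofPred_eq, stripWalks, Set.mem_singleton_iff]
      constructor
      · rintro ⟨-, h⟩
        funext i
        rw [Fin.fin_one_eq_zero i, h]
      · rintro rfl
        exact ⟨⟨fun _ => hs, fun i => i.elim0⟩, rfl⟩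
    rw [this]
    simp [stripCount, hs]
  | succ m ih =>
    by_cases hs : 0 ≤ s ∧ s ≤ N
    swap
    · exact hout _ s hs
    have : {t ∈ stripWalks N (m + 1) | t 0 = s} =
        (fun t : Fin (m + 1) → ℤ => (Fin.cons s t : Fin (m + 2) → ℤ)) ''
          ({t ∈ stripWalks N m | t 0 = s - 1} ∪ {t ∈ stripWalks N m | t 0 = s + 1}) := by
      ext t
      simp only [Set.mem_ofPred_eq, stripWalks, Set.mem_image, Set.mem_union]
      constructor
      · rintro ⟨⟨h1, h2⟩, h3⟩
        refine ⟨Fin.tail t, ?_, by rw [← h3]; exact Fin.cons_self_tail t⟩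
        have h4 := h2 0
        have h5 : (∀ i, 0 ≤ Fin.tail t i ∧ Fin.tail t i ≤ N) ∧ ∀ i : Fin m,
            Fin.tail t i.succ = Fin.tail t i.castSucc + 1 ∨
              Fin.tail t i.succ = Fin.tail t i.castSucc - 1 :=
          ⟨fun i => h1 i.succ, fun i => h2 i.succ⟩
        rw [Fin.castSucc_zero, h3] at h4
        rcases h4 with h4 | h4
        · exact Or.inr ⟨h5, h4⟩
        · exact Or.inl ⟨h5, h4⟩
      · rintro ⟨t, ht, rfl⟩
        have h5 : (∀ i, 0 ≤ t i ∧ t i ≤ N) ∧ ∀ i : Fin m,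
            t i.succ = t i.castSucc + 1 ∨ t i.succ = t i.castSucc - 1 := by
          rcases ht with ht | ht <;> exact ht.1
        refine ⟨⟨fun i => ?_, fun i => ?_⟩, rfl⟩
        · cases i using Fin.cases with
          | zero => exact hs
          | succ i => exact h5.1 i
        · cases i using Fin.cases with
          | zero =>
            simp only [Fin.cons_succ, Fin.castSucc_zero, Fin.cons_zero]
            rcases ht with ht | ht
            · exact Or.inr ht.2
            · exact Or.inl ht.2
          | succ i => exact h5.2 i
    rw [this, (Fin.cons_right_injective (α := fun _ => ℤ) s).encard_image,
      Set.encard_union_eq, ih, ih]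
    · simp [stripCount, hs]
    · rw [Set.disjoint_left]
      rintro t ⟨-, h1⟩ ⟨-, h2⟩
      omega

theorem encard_stripWalks_parity (N r : ℕ) (m : ℕ) (hr : r < 2) (hN : 0 < N) :
    {t ∈ stripWalks N m | t 0 % 2 = r}.encard =
      ((∑ k ∈ Finset.range ((N - r) / 2 + 1), stripCount N m (2 * k + r) : ℕ) : ℕ∞) := by
  have : {t ∈ stripWalks N m | t 0 % 2 = r} =
      ⋃ k ∈ (Finset.range ((N - r) / 2 + 1) : Set ℕ),
        {t ∈ stripWalks N m | t 0 = 2 * k + r} := by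
    ext t
    simp only [Set.mem_ofPred_eq, Set.mem_iUnion, Finset.coe_range, Set.mem_Iio, exists_prop]
    constructor
    · rintro ⟨h1, h2⟩
      have := h1.1 0
      exact ⟨((t 0 - r) / 2).toNat, by omega, h1, by omega⟩
    · rintro ⟨k, hk, h1, h2⟩
      exact ⟨h1, by omega⟩
  rw [this, Set.Finite.encard_biUnion (Finset.finite_toSet _), finsum_mem_coe_finset]
  · rw [Nat.cast_sum]
    exact Finset.sum_congr rfl fun k _ => encard_stripWalks_start _ _ _
  · intro a _ b _ hab
    rw [Function.onFun, Set.disjoint_left]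
    rintro t ⟨-, h1⟩ ⟨-, h2⟩
    omega

theorem stripWalks_step {N : ℤ} {m : ℕ} {t : Fin (m + 1) → ℤ} (ht : t ∈ stripWalks N m)
    {i j : Fin (m + 1)} (hij : (j : ℕ) = i + 1) : t j = t i + 1 ∨ t j = t i - 1 := by
  have h := ht.2 ⟨i, by omega⟩
  rwa [show (⟨i, by omega⟩ : Fin m).succ = j from Fin.ext hij.symm,
    show (⟨i, by omega⟩ : Fin m).castSucc = i from Fin.ext rfl] at h

theorem stripWalks_parity {N : ℤ} {m : ℕ} {t : Fin (m + 1) → ℤ} (ht : t ∈ stripWalks N m)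
    (j : Fin (m + 1)) : (t j - t 0 - (j : ℕ)) % 2 = 0 := by
  induction j using Fin.induction with
  | zero => simp
  | succ i ih =>
    have := ht.2 i
    rw [Fin.val_castSucc] at ih
    rw [Fin.val_succ]
    omega

/-- `t` records, in each column, the row at which the entries of `A` on the cells of parity `r`
switch from `1` to `0`. -/
def IsBoundary {n : ℕ} (A : Fin n × Fin n → Fin 2) (r : ℕ) (t : Fin n → ℤ) : Prop :=
  ∀ i j : Fin n, ((i : ℕ) + j) % 2 = r → (A (i, j) = 1 ↔ ((i : ℕ) : ℤ) < t j)

theorem IsBoundary.unique {m r : ℕ} {A : Fin (m + 1) × Fin (m + 1) → Fin 2}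
    {t t' : Fin (m + 1) → ℤ} (h : IsBoundary A r t) (h' : IsBoundary A r t')
    (ht : t ∈ stripWalks (m + 2 : ℕ) m) (ht' : t' ∈ stripWalks (m + 2 : ℕ) m)
    (hr : t 0 % 2 = r) (hr' : t' 0 % 2 = r) : t = t' := by
  have key : ∀ t t' : Fin (m + 1) → ℤ, IsBoundary A r t → IsBoundary A r t' →
      t ∈ stripWalks (m + 2 : ℕ) m → t' ∈ stripWalks (m + 2 : ℕ) m →
      t 0 % 2 = r → t' 0 % 2 = r → ∀ j, t' j ≤ t j := by
    intro t t' h h' ht ht' hr hr' j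
    by_contra! hlt
    have h1 := stripWalks_parity ht j
    have h2 := stripWalks_parity ht' j
    have h3 := ht.1 j
    have h4 := ht'.1 j
    have h5 : (t j).toNat < m + 1 := by omega
    have h6 := h ⟨(t j).toNat, h5⟩ j (by simp only; omega)
    have h7 := h' ⟨(t j).toNat, h5⟩ j (by simp only; omega)
    simp only at h6 h7
    have h8 := h6.1 (h7.2 (by omega))
    omega
  funext j
  exact le_antisymm (key _ _ h' h ht' ht hr' hr j) (key _ _ h h' ht ht' hr hr' j)

/-- The arrays counted by `a188818`. -/
def IsAvoiding {n : ℕ} (A : Fin n × Fin n → Fin 2) : Prop :=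
  ∀ p q : Fin n × Fin n, (q.1 : ℕ) = (p.1 : ℕ) + 1 →
    ((q.2 : ℕ) = (p.2 : ℕ) + 1 ∨ (p.2 : ℕ) = (q.2 : ℕ) + 1) → ¬(A p = 0 ∧ A q = 1)

theorem isAvoiding_of_isBoundary {m : ℕ} {A : Fin (m + 1) × Fin (m + 1) → Fin 2}
    (h : ∀ r < 2, ∃ t ∈ stripWalks (m + 2 : ℕ) m, IsBoundary A r t) : IsAvoiding A := by
  rintro ⟨i, j⟩ ⟨i', j'⟩ hi hj ⟨h0, h1⟩
  simp only at hi hj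
  obtain ⟨t, ht, hb⟩ := h (((i : ℕ) + j) % 2) (by omega)
  have h2 := (hb i' j' (by omega)).1 h1
  have h3 := mt (hb i j rfl).2 (by simp [h0])
  rcases hj with hj | hj
  · have := stripWalks_step ht hj
    omega
  · have := stripWalks_step ht hj
    omega

theorem IsAvoiding.exists_isBoundary {m r : ℕ} (hm : 0 < m) (hr : r < 2)
    {A : Fin (m + 1) × Fin (m + 1) → Fin 2} (hA : IsAvoiding A) :
    ∃ t ∈ stripWalks (m + 2 : ℕ) m, t 0 % 2 = r ∧ IsBoundary A r t := by
  classical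
  let P : Fin (m + 1) → ℕ → Prop := fun j i =>
    (i + j) % 2 = r ∧ ∀ hi : i < m + 1, A (⟨i, hi⟩, j) = 0
  have hbound : ∀ j, ∃ i, P j i ∧ i ≤ m + 2 := by
    intro j
    by_cases h : (m + 1 + j) % 2 = r
    · exact ⟨m + 1, ⟨h, fun hi => by omega⟩, by omega⟩
    · exact ⟨m + 2, ⟨by omega, fun hi => by omega⟩, le_rfl⟩
  have hex : ∀ j, ∃ i, P j i := fun j => (hbound j).imp fun _ h => h.1
  have hnext : ∀ (j j' : Fin (m + 1)) (i : ℕ), ((j' : ℕ) = j + 1 ∨ (j : ℕ) = j' + 1) →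
      P j i → P j' (i + 1) := by
    rintro j j' i hj ⟨h1, h2⟩
    refine ⟨by omega, fun hi => ?_⟩
    have := hA (⟨i, by omega⟩, j) (⟨i + 1, hi⟩, j') rfl hj
    have h3 := h2 (by omega)
    have h4 : A (⟨i + 1, hi⟩, j') ≠ 1 := fun h => this ⟨h3, h⟩
    omega
  have hnext2 : ∀ (j : Fin (m + 1)) (i : ℕ), P j i → P j (i + 2) := by
    intro j i h
    by_cases hj : (j : ℕ) + 1 < m + 1
    · exact hnext ⟨j + 1, hj⟩ j _ (Or.inr rfl) (hnext j ⟨j + 1, hj⟩ i (Or.inl rfl) h)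
    · have h1 : (j : ℕ) = (j - 1) + 1 := by omega
      exact hnext ⟨j - 1, by omega⟩ j _ (Or.inl h1) (hnext j ⟨j - 1, by omega⟩ i (Or.inr h1) h)
  have hadd : ∀ (j : Fin (m + 1)) (i d : ℕ), P j i → P j (i + 2 * d) := by
    intro j i d h
    induction d with
    | zero => exact h
    | succ d ih => exact hnext2 j _ ih
  let T : Fin (m + 1) → ℕ := fun j => Nat.find (hex j)
  have hspec : ∀ j, P j (T j) := fun j => Nat.find_spec (hex j)
  have hmin : ∀ j i, P j i → T j ≤ i := fun j i h => Nat.find_min' (hex j) h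
  clear_value T
  refine ⟨fun j => T j, ⟨fun j => ?_, fun i => ?_⟩, ?_, ?_⟩
  · obtain ⟨i, h1, h2⟩ := hbound j
    have := hmin j i h1
    simp only
    omega
  · have h1 := hmin _ _ (hnext i.castSucc i.succ _ (Or.inl (by simp)) (hspec _))
    have h2 := hmin _ _ (hnext i.succ i.castSucc _ (Or.inr (by simp)) (hspec _))
    have h3 := (hspec i.castSucc).1
    have h4 := (hspec i.succ).1
    rw [Fin.val_castSucc] at h3
    rw [Fin.val_succ] at h4
    simp only
    omega
  · have := (hspec 0).1
    rw [Fin.val_zero] at this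
    simp only
    omega
  · intro i j hij
    simp only [Nat.cast_lt]
    constructor
    · intro h
      by_contra! hle
      have h1 := (hspec j).1
      have h2 := hadd j _ (((i : ℕ) - T j) / 2) (hspec j)
      rw [show T j + 2 * (((i : ℕ) - T j) / 2) = i by omega] at h2
      have h3 := h2.2 i.2
      simp [h] at h3
    · intro h
      by_contra h1
      have h2 : A (i, j) = 0 := by omega
      have := hmin j i ⟨hij, fun _ => h2⟩
      omega

theorem natCast_a188818 (m : ℕ) (hm : 0 < m) :
    a188818 (m + 1) = {t ∈ stripWalks (m + 2 : ℕ) m | t 0 % 2 = (0 : ℕ)}.ncard *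
      {t ∈ stripWalks (m + 2 : ℕ) m | t 0 % 2 = (1 : ℕ)}.ncard := by
  rw [← Nat.card_coe_set_eq, ← Nat.card_coe_set_eq, ← Nat.card_prod]
  refine Nat.card_congr (Equiv.ofBijective (β := _ × _) (fun A =>
    have h := fun r hr => IsAvoiding.exists_isBoundary (r := r) hm hr A.2
    (⟨(h 0 (by omega)).choose, (h 0 (by omega)).choose_spec.1,
        (h 0 (by omega)).choose_spec.2.1⟩,
      ⟨(h 1 (by omega)).choose, (h 1 (by omega)).choose_spec.1,
        (h 1 (by omega)).choose_spec.2.1⟩)) ⟨?_, ?_⟩)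
  · intro A A' hAA'
    have h := fun r hr => IsAvoiding.exists_isBoundary (r := r) hm hr A.2
    have h' := fun r hr => IsAvoiding.exists_isBoundary (r := r) hm hr A'.2
    simp only [Prod.mk.injEq, Subtype.mk.injEq] at hAA'
    have h0 := (h 0 (by omega)).choose_spec.2.2
    have h1 := (h 1 (by omega)).choose_spec.2.2
    have h0' := (h' 0 (by omega)).choose_spec.2.2
    have h1' := (h' 1 (by omega)).choose_spec.2.2
    rw [← hAA'.1] at h0'
    rw [← hAA'.2] at h1'
    ext ⟨i, j⟩ : 2
    have : A.1 (i, j) = 1 ↔ A'.1 (i, j) = 1 := by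
      rcases Nat.mod_two_eq_zero_or_one ((i : ℕ) + j) with hp | hp
      · rw [h0 i j hp, h0' i j hp]
      · rw [h1 i j hp, h1' i j hp]
    omega
  · rintro ⟨⟨t, ht, hr⟩, ⟨t', ht', hr'⟩⟩
    let A : Fin (m + 1) × Fin (m + 1) → Fin 2 := fun p =>
      if ((p.1 : ℕ) : ℤ) < (if ((p.1 : ℕ) + p.2) % 2 = 0 then t p.2 else t' p.2) then 1 else 0
    have hb : IsBoundary A 0 t := fun i j hij => by simp [A, hij]
    have hb' : IsBoundary A 1 t' := fun i j hij => by simp [A, hij]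
    have hA : IsAvoiding A := by
      refine isAvoiding_of_isBoundary fun r hr => ?_
      interval_cases r
      exacts [⟨t, ht, hb⟩, ⟨t', ht', hb'⟩]
    have h := fun r hr => IsAvoiding.exists_isBoundary (r := r) hm hr hA
    refine ⟨⟨A, hA⟩, ?_⟩
    simp only [Prod.mk.injEq, Subtype.mk.injEq]
    exact ⟨(h 0 (by omega)).choose_spec.2.2.unique hb (h 0 (by omega)).choose_spec.1 ht
        (h 0 (by omega)).choose_spec.2.1 hr,
      (h 1 (by omega)).choose_spec.2.2.unique hb' (h 1 (by omega)).choose_spec.1 ht'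
        (h 1 (by omega)).choose_spec.2.1 hr'⟩

/-- For every `n ≥ 2`, `a(n) = e(n)·o(n)`, where
`e(n) = 2^{n-2} + 2·∑_{k=0}^{⌊(n+1)/2⌋} ∑_{ℓ=k+1}^{⌊(n+1)/2⌋} (C(n-1, n-k-ℓ) - C(n-1, n+k-ℓ+1))` and
`o(n) = 2^{n-2} + 2·∑_{k=0}^{⌊n/2⌋} ∑_{ℓ=k+1}^{⌊n/2⌋} (C(n-1, n-k-ℓ-1) - C(n-1, n+k-ℓ+1))`. -/
theorem stmt16 (n : ℕ) (hn : 2 ≤ n) :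
    (a188818 n : ℤ) =
      ((2 : ℤ) ^ (n - 2) + 2 * ∑ k ∈ Finset.range ((n + 1) / 2 + 1),
          ∑ l ∈ Finset.Icc (k + 1) ((n + 1) / 2),
            (ich ((n : ℤ) - 1) ((n : ℤ) - (k : ℤ) - (l : ℤ)) -
             ich ((n : ℤ) - 1) ((n : ℤ) + (k : ℤ) - (l : ℤ) + 1))) *
      ((2 : ℤ) ^ (n - 2) + 2 * ∑ k ∈ Finset.range (n / 2 + 1),
          ∑ l ∈ Finset.Icc (k + 1) (n / 2),
            (ich ((n : ℤ) - 1) ((n : ℤ) - (k : ℤ) - (l : ℤ) - 1) -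
             ich ((n : ℤ) - 1) ((n : ℤ) + (k : ℤ) - (l : ℤ) + 1))) := by
  have h0 := sum_stripCount n 0 hn (by omega)
  have h1 := sum_stripCount n 1 hn (by omega)
  obtain ⟨m, rfl⟩ : ∃ m, n = m + 1 := ⟨n - 1, by omega⟩
  have hcard : ∀ r < 2, {t ∈ stripWalks (m + 2 : ℕ) m | t 0 % 2 = (r : ℕ)}.ncard =
      ∑ k ∈ Finset.range ((m + 1 + 1 - r) / 2 + 1),
        stripCount ((m + 1 : ℕ) + 1) (m + 1 - 1) (2 * k + r) := by
    intro r hr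
    rw [Set.ncard, encard_stripWalks_parity (m + 2) r m hr (by omega), ENat.toNat_natCast]
    rfl
  rw [natCast_a188818 m (by omega), hcard 0 (by omega), hcard 1 (by omega), Nat.cast_mul, h0, h1]
  simp only [Nat.cast_zero, Nat.cast_one, sub_zero, Nat.sub_zero, Nat.add_sub_cancel]
end

section
/- There exist polynomials p0, …, p4 ∈ ℤ[x], each of degree at most 14 and with p4 ≠ 0, such that p0(n)·a(n) + p1(n)·a(n+1) + ⋯ + p4(n)·a(n+4) = 0 for all integers n ≥ 1. In particular, the sequence a is D-finite. -/
/-- `a306322 n` is the number of `n × n` matrices with nonnegative integer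
entries such that the top-left entry is `0`, the bottom-right entry is `2`, and
along every row, column and falling diagonal any two consecutive entries `e, e'`
satisfy `e' - e ∈ {0, 1}` (OEIS A306322). -/
noncomputable def a306322 (n : ℕ) : ℕ :=
  Nat.card {m : Fin n × Fin n → ℕ //
    (∀ p : Fin n × Fin n, (p.1 : ℕ) = 0 → (p.2 : ℕ) = 0 → m p = 0) ∧
    (∀ p : Fin n × Fin n, (p.1 : ℕ) = n - 1 → (p.2 : ℕ) = n - 1 → m p = 2) ∧
    (∀ p q : Fin n × Fin n,
      ((q.1 = p.1 ∧ (q.2 : ℕ) = (p.2 : ℕ) + 1) ∨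
       ((q.1 : ℕ) = (p.1 : ℕ) + 1 ∧ q.2 = p.2) ∨
       ((q.1 : ℕ) = (p.1 : ℕ) + 1 ∧ (q.2 : ℕ) = (p.2 : ℕ) + 1)) →
      m p ≤ m q ∧ m q ≤ m p + 1)}

/-- The number of parallelogram polyominoes with an `(i+1) × (j+1)` bounding box. -/
def parallelogramCount (i j : ℕ) : ℚ :=
  ((i + j + 1).factorial * (i + j).factorial) /
    ((i + 1).factorial * i.factorial * (j + 1).factorial * j.factorial)

theorem parallelogramCount_comm (i j : ℕ) :
    parallelogramCount i j = parallelogramCount j i := by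
  unfold parallelogramCount
  rw [add_comm i j]
  congr 1
  ring

theorem parallelogramCount_succ_left (i j : ℕ) :
    ((i : ℚ) + 2) * (i + 1) * parallelogramCount (i + 1) j =
      (i + j + 2) * (i + j + 1) * parallelogramCount i j := by
  unfold parallelogramCount
  rw [show i + 1 + j + 1 = (i + j + 1) + 1 by ring, show i + 1 + j = (i + j) + 1 by ring]
  have h1 := Nat.factorial_ne_zero i
  have h2 := Nat.factorial_ne_zero j
  simp only [Nat.factorial_succ]
  push_cast
  field_simp
  ring

theorem parallelogramCount_succ_right (i j : ℕ) :
    ((j : ℚ) + 2) * (j + 1) * parallelogramCount i (j + 1) =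
      (i + j + 2) * (i + j + 1) * parallelogramCount i j := by
  rw [parallelogramCount_comm i (j + 1), parallelogramCount_succ_left, parallelogramCount_comm j i]
  ring

/-- The sum of `parallelogramCount` over the first `m` entries of row `i`. -/
def rowSum (i m : ℕ) : ℚ := ∑ j ∈ Finset.range m, parallelogramCount i j

/-- The sum of `parallelogramCount` over the square `[0, m) × [0, m)`. -/
def squareSum (m : ℕ) : ℚ := ∑ i ∈ Finset.range m, rowSum i m

theorem squareSum_succ (m : ℕ) :
    squareSum (m + 1) = squareSum m + 2 * rowSum m (m + 1) - parallelogramCount m m := by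
  have h : ∑ i ∈ Finset.range m, parallelogramCount i m = rowSum m m :=
    Finset.sum_congr rfl fun i _ => parallelogramCount_comm i m
  simp only [squareSum, rowSum, Finset.sum_range_succ, Finset.sum_add_distrib] at h ⊢
  rw [h]
  ring

theorem weighted_rowSum (i m : ℕ) :
    2 * ∑ j ∈ Finset.range (m + 1), ((j : ℚ) + 1) * parallelogramCount i j * (i + 1) =
      -(i * (i + 1)) * rowSum i (m + 1) +
        (i + m + 2) * (i + m + 1) * parallelogramCount i m := by
  induction m with
  | zero =>
    simp [rowSum]
    ring
  | succ m ih =>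
    rw [Finset.sum_range_succ, mul_add, ih, rowSum, rowSum,
      Finset.sum_range_succ _ (m + 1)]
    have h := parallelogramCount_succ_right i m
    push_cast
    linear_combination -h

theorem rowSum_succ_left (i m : ℕ) :
    2 * (2 * (i : ℚ) + 3) * (i + 1) * (i + 2) * rowSum (i + 1) (m + 1) =
      i * (i + 1) * (i + 2) * rowSum i (m + 1) +
        (i + m + 2) * (i + m + 1) * (2 * m + 3 * i + 6) * parallelogramCount i m := by
  induction m with
  | zero =>
    have h := parallelogramCount_succ_left i 0
    simp only [rowSum, zero_add, Finset.sum_range_one]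
    push_cast at h ⊢
    linear_combination 2 * (2 * (i : ℚ) + 3) * h
  | succ m ih =>
    have h := parallelogramCount_succ_right i m
    have h' := parallelogramCount_succ_left i (m + 1)
    simp only [rowSum, Finset.sum_range_succ _ (m + 1)] at ih ⊢
    push_cast at h' ⊢
    linear_combination ih + 2 * (2 * (i : ℚ) + 3) * h' - (2 * m + 3 * i + 6) * h

theorem rowSum_diag_succ (m : ℕ) :
    (2 * (m : ℚ) + 3) * (m + 2) ^ 2 * rowSum (m + 1) (m + 2) =
      m * (m + 2) ^ 2 / 2 * rowSum m (m + 1) +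
        (2 * m + 1) * ((m + 2) * (5 * m + 6) + 4 * (2 * m + 3) ^ 2)
          * parallelogramCount m m := by
  have h := rowSum_succ_left m m
  have h1 := parallelogramCount_succ_left m m
  have h2 := parallelogramCount_succ_right (m + 1) m
  have e : rowSum (m + 1) (m + 2) =
      rowSum (m + 1) (m + 1) + parallelogramCount (m + 1) (m + 1) := by
    rw [rowSum, Finset.sum_range_succ, rowSum]
  rw [e]
  push_cast at h2
  apply mul_left_cancel₀ (show (m : ℚ) + 1 ≠ 0 by positivity)
  linear_combination (m + 2 : ℚ) / 2 * h + (2 * (m : ℚ) + 3) * (m + 2) * h2 +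
    (2 * (m : ℚ) + 3) * (2 * m + 3) * 2 * h1

theorem parallelogramCount_diag_succ (m : ℕ) :
    ((m : ℚ) + 2) ^ 2 * parallelogramCount (m + 1) (m + 1) =
      4 * (2 * m + 3) * (2 * m + 1) * parallelogramCount m m := by
  have h1 := parallelogramCount_succ_left m m
  have h2 := parallelogramCount_succ_right (m + 1) m
  push_cast at h2
  have h3 : ((m : ℚ) + 1) ^ 2 ≠ 0 := by positivity
  apply mul_left_cancel₀ h3
  linear_combination ((m : ℚ) + 1) * (m + 2) * h2 + (2 * m + 3) * (2 * m + 2) * h1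

/-- The coefficient of `a n` in the recurrence, evaluated at `x`. -/
def recCoeff₀ {R : Type*} [CommRing R] (x : R) : R :=
    7560000 * x ^ 14 + 170676000 * x ^ 13 + 1716022800 * x ^ 12 + 10127022840 * x ^ 11
    + 38880016200 * x ^ 10 + 101519240688 * x ^ 9 + 182402937024 * x ^ 8 + 221267363352 * x ^ 7
    + 168382354376 * x ^ 6 + 60393640672 * x ^ 5 - 14323327264 * x ^ 4 - 24962912512 * x ^ 3
    - 9946663936 * x ^ 2 - 1397667840 * x

/-- The coefficient of `a (n + 1)` in the recurrence, evaluated at `x`. -/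
def recCoeff₁ {R : Type*} [CommRing R] (x : R) : R :=
    -40162500 * x ^ 14 - 923726250 * x ^ 13 - 9488261250 * x ^ 12 - 57406427550 * x ^ 11
    - 226987650810 * x ^ 10 - 614268658890 * x ^ 9 - 1154754343086 * x ^ 8
    - 1489620330618 * x ^ 7 - 1248802859354 * x ^ 6 - 565086760292 * x ^ 5 + 5869320776 * x ^ 4
    + 163584337648 * x ^ 3 + 88995605504 * x ^ 2 + 20161527552 * x + 1636024320

/-- The coefficient of `a (n + 2)` in the recurrence, evaluated at `x`. -/
def recCoeff₂ {R : Type*} [CommRing R] (x : R) : R :=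
    42170625 * x ^ 14 + 981642375 * x ^ 13 + 10209053025 * x ^ 12 + 62559627795 * x ^ 11
    + 250621464735 * x ^ 10 + 687475711989 * x ^ 9 + 1311094658043 * x ^ 8
    + 1718884004625 * x ^ 7 + 1471227292164 * x ^ 6 + 691541238960 * x ^ 5 + 14462120192 * x ^ 4
    - 188403075920 * x ^ 3 - 108128100864 * x ^ 2 - 25779317504 * x - 2257059840

/-- The coefficient of `a (n + 3)` in the recurrence, evaluated at `x`. -/
def recCoeff₃ {R : Type*} [CommRing R] (x : R) : R :=
    -10040625 * x ^ 14 - 240676875 * x ^ 13 - 2573859375 * x ^ 12 - 16188175575 * x ^ 11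
    - 66409921665 * x ^ 10 - 186060791565 * x ^ 9 - 361436727669 * x ^ 8 - 481461765909 * x ^ 7
    - 418109008130 * x ^ 6 - 200066710012 * x ^ 5 - 6482362536 * x ^ 4 + 53280967424 * x ^ 3
    + 31127345920 * x ^ 2 + 7507267072 * x + 664043520

/-- The coefficient of `a (n + 4)` in the recurrence, evaluated at `x`. -/
def recCoeff₄ {R : Type*} [CommRing R] (x : R) : R :=
    472500 * x ^ 14 + 12084750 * x ^ 13 + 137044800 * x ^ 12 + 907952490 * x ^ 11
    + 3896091540 * x ^ 10 + 11334497778 * x ^ 9 + 22693475688 * x ^ 8 + 30930728550 * x ^ 7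
    + 27302220944 * x ^ 6 + 13218590672 * x ^ 5 + 474248832 * x ^ 4 - 3499316640 * x ^ 3
    - 2048186624 * x ^ 2 - 491809280 * x - 43008000

/-- The value of `a306322 (m + 1)` in terms of sums of `parallelogramCount`. -/
def matrixCount (m : ℕ) : ℚ :=
  2 * squareSum (m + 1) + 3 * m * rowSum m (m + 1) - (4 * m + 1) * parallelogramCount m m -
    2 * (m + 1).centralBinom + 3

theorem matrixCount_recurrence (m : ℕ) :
    recCoeff₀ ((m : ℚ) + 1) * matrixCount m + recCoeff₁ ((m : ℚ) + 1) * matrixCount (m + 1) +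
      recCoeff₂ ((m : ℚ) + 1) * matrixCount (m + 2) +
      recCoeff₃ ((m : ℚ) + 1) * matrixCount (m + 3) +
      recCoeff₄ ((m : ℚ) + 1) * matrixCount (m + 4) = 0 := by
  have hA0 := squareSum_succ (m + 1)
  have hA1 := squareSum_succ (m + 2)
  have hA2 := squareSum_succ (m + 3)
  have hA3 := squareSum_succ (m + 4)
  have hs0 := rowSum_diag_succ m
  have hs1 := rowSum_diag_succ (m + 1)
  have hs2 := rowSum_diag_succ (m + 2)
  have hs3 := rowSum_diag_succ (m + 3)
  have hP0 := parallelogramCount_diag_succ m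
  have hP1 := parallelogramCount_diag_succ (m + 1)
  have hP2 := parallelogramCount_diag_succ (m + 2)
  have hP3 := parallelogramCount_diag_succ (m + 3)
  have hC (k : ℕ) : ((k : ℚ) + 1) * (k + 1).centralBinom = 2 * (2 * k + 1) * k.centralBinom := by
    exact_mod_cast Nat.succ_mul_centralBinom_succ k
  have hC0 := hC (m + 1)
  have hC1 := hC (m + 2)
  have hC2 := hC (m + 3)
  have hC3 := hC (m + 4)
  unfold matrixCount
  simp only [add_assoc, Nat.reduceAdd] at *
  push_cast at *
  generalize (squareSum (m + 1)) = A0 at *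
  generalize (squareSum (m + 2)) = A1 at *
  generalize (squareSum (m + 3)) = A2 at *
  generalize (squareSum (m + 4)) = A3 at *
  generalize (squareSum (m + 5)) = A4 at *
  generalize (rowSum m (m + 1)) = s0 at *
  generalize (rowSum (m + 1) (m + 2)) = s1 at *
  generalize (rowSum (m + 2) (m + 3)) = s2 at *
  generalize (rowSum (m + 3) (m + 4)) = s3 at *
  generalize (rowSum (m + 4) (m + 5)) = s4 at *
  generalize (parallelogramCount m m) = P0 at *
  generalize (parallelogramCount (m + 1) (m + 1)) = P1 at *
  generalize (parallelogramCount (m + 2) (m + 2)) = P2 at *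
  generalize (parallelogramCount (m + 3) (m + 3)) = P3 at *
  generalize (parallelogramCount (m + 4) (m + 4)) = P4 at *
  generalize ((m + 1).centralBinom : ℚ) = C0 at *
  generalize ((m + 2).centralBinom : ℚ) = C1 at *
  generalize ((m + 3).centralBinom : ℚ) = C2 at *
  generalize ((m + 4).centralBinom : ℚ) = C3 at *
  generalize ((m + 5).centralBinom : ℚ) = C4 at *
  have hm : (0 : ℚ) ≤ m := Nat.cast_nonneg m
  generalize (m : ℚ) = x at *
  clear hC
  subst hA0 hA1 hA2 hA3
  obtain ⟨u0, rfl⟩ : ∃ u0, C0 = (x + 2) * (x + 3) * (x + 4) * (x + 5) * u0 :=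
    ⟨C0 / ((x + 2) * (x + 3) * (x + 4) * (x + 5)), by field_simp⟩
  obtain ⟨w0, rfl⟩ : ∃ w0, P0 = (x + 2) ^ 2 * (x + 3) ^ 2 * (x + 4) ^ 2 * (x + 5) ^ 2 * (2 * x +
      3) * (2 * x + 5) * (2 * x + 7) * (2 * x + 9) * w0 :=
    ⟨P0 / ((x + 2) ^ 2 * (x + 3) ^ 2 * (x + 4) ^ 2 * (x + 5) ^ 2 * (2 * x + 3) * (2 * x + 5) *
        (2 * x + 7) * (2 * x + 9)), by field_simp⟩
  obtain ⟨v0, rfl⟩ : ∃ v0, s0 = (2 * x + 3) * (2 * x + 5) * (2 * x + 7) * (2 * x + 9) * v0 :=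
    ⟨s0 / ((2 * x + 3) * (2 * x + 5) * (2 * x + 7) * (2 * x + 9)), by field_simp⟩
  obtain ⟨u1, hu1⟩ : ∃ u1, u1 = 2 * (2 * x + 3) * u0 := ⟨_, rfl⟩
  obtain rfl : C1 = (x + 3) * (x + 4) * (x + 5) * u1 := by
    apply mul_left_cancel₀ (show x + 2 ≠ 0 by positivity)
    linear_combination hC0 - (x + 2) * (x + 3) * (x + 4) * (x + 5) * hu1
  obtain ⟨w1, hw1⟩ : ∃ w1, w1 = 4 * (2 * x + 3) ^ 2 * (2 * x + 1) * w0 := ⟨_, rfl⟩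
  obtain rfl : P1 = (x + 3) ^ 2 * (x + 4) ^ 2 * (x + 5) ^ 2 * (2 * x + 5) * (2 * x + 7) * (2 * x
      + 9) * w1 := by
    apply mul_left_cancel₀ (show (x + 2) ^ 2 ≠ 0 by positivity)
    linear_combination hP0 - (x + 2) ^ 2 * (x + 3) ^ 2 * (x + 4) ^ 2 * (x + 5) ^ 2 * (2 * x + 5)
        * (2 * x + 7) * (2 * x + 9) * hw1
  obtain ⟨v1, hv1⟩ : ∃ v1, v1 = x / 2 * v0 + (2 * x + 1) * ((x + 2) * (5 * x + 6) + 4 * (2 * x +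
      3) ^ 2) * (x + 3) ^ 2 * (x + 4) ^ 2 * (x + 5) ^ 2 * w0 := ⟨_, rfl⟩
  obtain rfl : s1 = (2 * x + 5) * (2 * x + 7) * (2 * x + 9) * v1 := by
    apply mul_left_cancel₀ (show (2 * x + 3) * (x + 2) ^ 2 ≠ 0 by positivity)
    linear_combination hs0 - (2 * x + 3) * (x + 2) ^ 2 * (2 * x + 5) * (2 * x + 7) * (2 * x + 9)
        * hv1
  obtain ⟨u2, hu2⟩ : ∃ u2, u2 = 2 * (2 * x + 5) * u1 := ⟨_, rfl⟩
  obtain rfl : C2 = (x + 4) * (x + 5) * u2 := by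
    apply mul_left_cancel₀ (show x + 3 ≠ 0 by positivity)
    linear_combination hC1 - (x + 3) * (x + 4) * (x + 5) * hu2
  obtain ⟨w2, hw2⟩ : ∃ w2, w2 = 4 * (2 * x + 5) ^ 2 * (2 * x + 3) * w1 := ⟨_, rfl⟩
  obtain rfl : P2 = (x + 4) ^ 2 * (x + 5) ^ 2 * (2 * x + 7) * (2 * x + 9) * w2 := by
    apply mul_left_cancel₀ (show (x + 3) ^ 2 ≠ 0 by positivity)
    linear_combination hP1 - (x + 3) ^ 2 * (x + 4) ^ 2 * (x + 5) ^ 2 * (2 * x + 7) * (2 * x + 9)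
        * hw2
  obtain ⟨v2, hv2⟩ : ∃ v2, v2 = (x + 1) / 2 * v1 + (2 * x + 3) * ((x + 3) * (5 * x + 11) + 4 *
      (2 * x + 5) ^ 2) * (x + 4) ^ 2 * (x + 5) ^ 2 * w1 := ⟨_, rfl⟩
  obtain rfl : s2 = (2 * x + 7) * (2 * x + 9) * v2 := by
    apply mul_left_cancel₀ (show (2 * x + 5) * (x + 3) ^ 2 ≠ 0 by positivity)
    linear_combination hs1 - (2 * x + 5) * (x + 3) ^ 2 * (2 * x + 7) * (2 * x + 9) * hv2
  obtain ⟨u3, hu3⟩ : ∃ u3, u3 = 2 * (2 * x + 7) * u2 := ⟨_, rfl⟩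
  obtain rfl : C3 = (x + 5) * u3 := by
    apply mul_left_cancel₀ (show x + 4 ≠ 0 by positivity)
    linear_combination hC2 - (x + 4) * (x + 5) * hu3
  obtain ⟨w3, hw3⟩ : ∃ w3, w3 = 4 * (2 * x + 7) ^ 2 * (2 * x + 5) * w2 := ⟨_, rfl⟩
  obtain rfl : P3 = (x + 5) ^ 2 * (2 * x + 9) * w3 := by
    apply mul_left_cancel₀ (show (x + 4) ^ 2 ≠ 0 by positivity)
    linear_combination hP2 - (x + 4) ^ 2 * (x + 5) ^ 2 * (2 * x + 9) * hw3
  obtain ⟨v3, hv3⟩ : ∃ v3, v3 = (x + 2) / 2 * v2 + (2 * x + 5) * ((x + 4) * (5 * x + 16) + 4 *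
      (2 * x + 7) ^ 2) * (x + 5) ^ 2 * w2 := ⟨_, rfl⟩
  obtain rfl : s3 = (2 * x + 9) * v3 := by
    apply mul_left_cancel₀ (show (2 * x + 7) * (x + 4) ^ 2 ≠ 0 by positivity)
    linear_combination hs2 - (2 * x + 7) * (x + 4) ^ 2 * (2 * x + 9) * hv3
  obtain ⟨u4, hu4⟩ : ∃ u4, u4 = 2 * (2 * x + 9) * u3 := ⟨_, rfl⟩
  obtain rfl : C4 = u4 := by
    apply mul_left_cancel₀ (show x + 5 ≠ 0 by positivity)
    linear_combination hC3 - (x + 5) * hu4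
  obtain ⟨w4, hw4⟩ : ∃ w4, w4 = 4 * (2 * x + 9) ^ 2 * (2 * x + 7) * w3 := ⟨_, rfl⟩
  obtain rfl : P4 = w4 := by
    apply mul_left_cancel₀ (show (x + 5) ^ 2 ≠ 0 by positivity)
    linear_combination hP3 - (x + 5) ^ 2 * hw4
  obtain ⟨v4, hv4⟩ : ∃ v4, v4 = (x + 3) / 2 * v3 + (2 * x + 7) * ((x + 5) * (5 * x + 21) + 4 *
      (2 * x + 9) ^ 2) * w3 := ⟨_, rfl⟩
  obtain rfl : s4 = v4 := by
    apply mul_left_cancel₀ (show (2 * x + 9) * (x + 5) ^ 2 ≠ 0 by positivity)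
    linear_combination hs3 - (2 * x + 9) * (x + 5) ^ 2 * hv4
  clear hC0 hC1 hC2 hC3 hP0 hP1 hP2 hP3 hs0 hs1 hs2 hs3
  simp only [recCoeff₀, recCoeff₁, recCoeff₂, recCoeff₃, recCoeff₄, hu4, hu3, hu2, hu1, hv4,
    hv3, hv2, hv1, hw4, hw3, hw2, hw1]
  ring

theorem sum_multichoose (k p : ℕ) :
    ∑ z ∈ Finset.range (p + 1), (k.multichoose z : ℚ) = (k + 1).multichoose p := by
  induction p with
  | zero => simp
  | succ p ih =>
    rw [Finset.sum_range_succ, ih, Nat.multichoose_succ_succ]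
    push_cast
    ring

/-- The two-path Lindström–Gessel–Viennot determinant. -/
def pathDet (k p q : ℕ) : ℚ :=
  (k + 1).multichoose p * k.multichoose q - k.multichoose p * (k + 1).multichoose q

theorem pathDet_zero_left {p : ℕ} (hp : 0 < p) (q : ℕ) :
    pathDet 0 p q = if q = 0 then 1 else 0 := by
  obtain ⟨p, rfl⟩ := Nat.exists_eq_succ_of_ne_zero hp.ne'
  cases q <;> simp [pathDet]

theorem sum_pathDet (k : ℕ) {p q : ℕ} (h : q ≤ p) :
    ∑ x ∈ Finset.Ico (q + 1) (p + 1), ∑ y ∈ Finset.range (q + 1), pathDet k x y =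
      pathDet (k + 1) p q := by
  simp only [pathDet, Finset.sum_sub_distrib, ← Finset.mul_sum, ← Finset.sum_mul]
  rw [Finset.sum_Ico_eq_sub _ (by omega), Finset.sum_Ico_eq_sub _ (by omega)]
  simp only [sum_multichoose]
  ring

theorem sum_pathDet_row (k p : ℕ) :
    ∑ q ∈ Finset.range (p + 1), pathDet k (p + 1) q = parallelogramCount k p := by
  simp only [pathDet, Finset.sum_sub_distrib, ← Finset.mul_sum, sum_multichoose]
  have h1 (a b : ℕ) : ((a + 1).multichoose b : ℚ) =
      (a + b).factorial / (a.factorial * b.factorial) := by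
    rw [Nat.multichoose_eq, show a + 1 + b - 1 = b + a by omega, Nat.cast_add_choose, add_comm b,
      mul_comm (b.factorial : ℚ)]
  have h2 : (k.multichoose (p + 1) : ℚ) =
      k * (k + p).factorial / (k.factorial * (p + 1).factorial) := by
    rcases k with - | k
    · simp
    · rw [h1, show k + 1 + p = k + (p + 1) by ring, Nat.factorial_succ k]
      push_cast
      field_simp
  rw [h2, h1, h1, h1 (k + 1) p, parallelogramCount, show k + 1 + p = k + p + 1 by ring,
    ← add_assoc]
  simp only [Nat.factorial_succ]
  push_cast
  have := Nat.factorial_ne_zero k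
  have := Nat.factorial_ne_zero p
  field_simp
  ring

theorem sum_shifted_pathDet (k : ℕ) {p q : ℕ} (h : q ≤ p) :
    ∑ x ∈ Finset.Ico (q + 1) (p + 1), ∑ y ∈ Finset.range (q + 1), ∑ z ∈ Finset.range (y + 1),
        pathDet k (x - z) (y - z) =
      ∑ z ∈ Finset.range (q + 1), pathDet (k + 1) (p - z) (q - z) := by
  have h1 (x : ℕ) := Finset.sum_range_diag_flip (q + 1) fun z y => pathDet k (x - z) y
  simp only [h1]
  rw [Finset.sum_comm]
  refine Finset.sum_congr rfl fun z hz => ?_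
  rw [Finset.mem_range] at hz
  rw [← sum_pathDet k (show q - z ≤ p - z by omega), Finset.sum_Ico_eq_sum_range,
    Finset.sum_Ico_eq_sum_range, show q + 1 - z = q - z + 1 by omega,
    show p + 1 - (q + 1) = p - z + 1 - (q - z + 1) by omega]
  refine Finset.sum_congr rfl fun i _ => ?_
  rw [show q + 1 + i - z = q - z + 1 + i by omega]

theorem sum_shifted_pathDet_row (k p : ℕ) :
    ∑ q ∈ Finset.range p, ∑ z ∈ Finset.range (q + 1), pathDet k (p - z) (q - z) =
      ∑ j ∈ Finset.range p, parallelogramCount k j := by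
  rw [Finset.sum_range_diag_flip p fun z y => pathDet k (p - z) y, ← Finset.sum_range_reflect]
  refine Finset.sum_congr rfl fun i hi => ?_
  rw [Finset.mem_range] at hi
  rw [show p - (p - 1 - i) = i + 1 by omega, sum_pathDet_row]

/-- A row of a matrix of width `n` is encoded by the number `p` of its nonzero entries and the
number `q` of its entries equal to `2`. -/
def IsRowState (n p q : ℕ) : Prop :=
  q ≤ p ∧ p ≤ n ∧ (p = q → p = 0 ∨ p = n)

/-- The row with the second pair of counts may be placed directly below the row with the first
pair. -/
def RowStep (n p q p' q' : ℕ) : Prop :=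
  p ≤ p' ∧ q ≤ q' ∧ q' ≤ p ∧ (p = n ∨ q' = 0 ∨ q' < p)

open Classical in
/-- The number of ways to choose `m + 1` rows with first entry of the first row equal to `0` and
last row encoded by `(p, q)`. -/
noncomputable def stateCount (n : ℕ) : ℕ → ℕ → ℕ → ℚ
  | 0, p, q => if IsRowState n p q ∧ p < n then 1 else 0
  | m + 1, p', q' => ∑ p ∈ Finset.range (n + 1), ∑ q ∈ Finset.range (n + 1),
      if RowStep n p q p' q' ∧ IsRowState n p' q' then stateCount n m p q else 0

theorem stateCount_of_not_isRowState {n m p q : ℕ} (h : ¬ IsRowState n p q) :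
    stateCount n m p q = 0 := by
  cases m <;> simp [stateCount, h]

theorem stateCount_zero_zero {n : ℕ} (hn : 0 < n) (m : ℕ) : stateCount n m 0 0 = 1 := by
  induction m with
  | zero => simp [stateCount, IsRowState, hn]
  | succ m ih =>
    rw [stateCount, Finset.sum_eq_single 0, Finset.sum_eq_single 0]
    · simp [RowStep, IsRowState, ih]
    · intro q _ hq
      simp [RowStep, hq]
    · simp
    · intro p _ hp
      simp [RowStep, hp]
    · simp

theorem stateCount_succ_of_lt {n p q : ℕ} (m : ℕ) (hq : q < p) (hp : p ≤ n) :
    stateCount n (m + 1) p q =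
      ∑ x ∈ Finset.Ico (q + 1) (p + 1), ∑ y ∈ Finset.range (q + 1), stateCount n m x y +
        if q = 0 then 1 else 0 := by
  have hn : 0 < n := by omega
  have hstate : IsRowState n p q := ⟨hq.le, hp, fun h => by omega⟩
  have hx : Finset.Ico (q + 1) (p + 1) = {x ∈ Finset.range (n + 1) | q < x ∧ x ≤ p} := by
    ext x
    simp
    omega
  have hy : Finset.range (q + 1) = {y ∈ Finset.range (n + 1) | y ≤ q} := by
    ext y
    simp
    omega
  have h0 : (if q = 0 then (1 : ℚ) else 0) = ∑ x ∈ Finset.range (n + 1),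
      ∑ y ∈ Finset.range (n + 1), if x = 0 ∧ y = 0 ∧ q = 0 then 1 else 0 := by
    rw [Finset.sum_eq_single 0, Finset.sum_eq_single 0] <;> simp +contextual
  rw [h0, hx, hy, Finset.sum_filter]
  simp only [Finset.sum_filter]
  rw [stateCount, ← Finset.sum_add_distrib]
  refine Finset.sum_congr rfl fun x _ => ?_
  have hite (f : ℕ → ℚ) (c : Prop) [Decidable c] :
      (if c then ∑ y ∈ Finset.range (n + 1), f y else 0) =
        ∑ y ∈ Finset.range (n + 1), if c then f y else 0 := by
    split_ifs <;> simp
  rw [hite, ← Finset.sum_add_distrib]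
  refine Finset.sum_congr rfl fun y _ => ?_
  classical
  by_cases h : x = 0 ∧ y = 0 ∧ q = 0
  · obtain ⟨rfl, rfl, rfl⟩ := h
    simp [RowStep, hstate, stateCount_zero_zero hn]
  · rw [if_neg h, add_zero, ← ite_and]
    by_cases hxy : (q < x ∧ x ≤ p) ∧ y ≤ q
    · rw [if_pos hxy, if_pos ⟨⟨hxy.1.2, hxy.2, hxy.1.1.le, Or.inr (Or.inr hxy.1.1)⟩, hstate⟩]
    · rw [if_neg hxy]
      refine ite_eq_right_iff.2 fun hstep => stateCount_of_not_isRowState fun hs => ?_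
      unfold RowStep at hstep
      unfold IsRowState at hs
      omega

theorem stateCount_succ_top {n : ℕ} (m : ℕ) :
    stateCount n (m + 1) n n =
      ∑ y ∈ Finset.range n, stateCount n m n y + stateCount n m n n := by
  rw [stateCount, Finset.sum_eq_single n, ← Finset.sum_range_succ]
  · refine Finset.sum_congr rfl fun y hy => ?_
    rw [Finset.mem_range] at hy
    rw [if_pos]
    exact ⟨⟨le_rfl, by omega, le_rfl, Or.inl rfl⟩, le_rfl, le_rfl, fun _ => Or.inr rfl⟩
  · intro x hx hxn
    rw [Finset.mem_range] at hx
    refine Finset.sum_eq_zero fun y _ => if_neg fun h => ?_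
    have := h.1.2.2.1
    omega
  · simp

theorem stateCount_top {n : ℕ} (m : ℕ) :
    stateCount n m n n = ∑ k ∈ Finset.range m, ∑ y ∈ Finset.range n, stateCount n k n y := by
  induction m with
  | zero => simp [stateCount]
  | succ m ih => rw [stateCount_succ_top, ih, Finset.sum_range_succ, add_comm]

theorem stateCount_of_lt {n p q : ℕ} (m : ℕ) (hq : q < p) (hp : p ≤ n) :
    stateCount n m p q =
      ∑ z ∈ Finset.range (q + 1), pathDet m (p - z) (q - z) +
        ∑ k ∈ Finset.range m, pathDet k p q -
          if p = n then ((m + 1).multichoose q : ℚ) else 0 := by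
  induction m generalizing p q with
  | zero =>
    have hstate : IsRowState n p q := ⟨hq.le, hp, fun h => by omega⟩
    rw [Finset.sum_eq_single_of_mem q (Finset.self_mem_range_succ q)]
    · simp [stateCount, hstate, pathDet_zero_left (show 0 < p - q by omega)]
      split_ifs <;> first | omega | norm_num
    · intro z hz hzq
      rw [Finset.mem_range] at hz
      rw [pathDet_zero_left (by omega), if_neg (by omega)]
  | succ m ih =>
    rw [stateCount_succ_of_lt m hq hp]
    have h : ∑ x ∈ Finset.Ico (q + 1) (p + 1), ∑ y ∈ Finset.range (q + 1), stateCount n m x y =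
        ∑ x ∈ Finset.Ico (q + 1) (p + 1), ∑ y ∈ Finset.range (q + 1),
          (∑ z ∈ Finset.range (y + 1), pathDet m (x - z) (y - z) +
            ∑ k ∈ Finset.range m, pathDet k x y -
              if x = n then ((m + 1).multichoose y : ℚ) else 0) := by
      refine Finset.sum_congr rfl fun x hx => Finset.sum_congr rfl fun y hy => ?_
      rw [Finset.mem_Ico] at hx
      rw [Finset.mem_range] at hy
      exact ih (by omega) (by omega)
    rw [h]
    simp only [Finset.sum_add_distrib, Finset.sum_sub_distrib]
    have hk : ∑ x ∈ Finset.Ico (q + 1) (p + 1), ∑ y ∈ Finset.range (q + 1),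
        ∑ k ∈ Finset.range m, pathDet k x y = ∑ k ∈ Finset.range m, pathDet (k + 1) p q := by
      simp only [fun x => Finset.sum_comm (s := Finset.range (q + 1)) (t := Finset.range m)
        (f := fun y k => pathDet k x y)]
      rw [Finset.sum_comm]
      exact Finset.sum_congr rfl fun k _ => sum_pathDet k hq.le
    have ht : ∑ x ∈ Finset.Ico (q + 1) (p + 1), ∑ y ∈ Finset.range (q + 1),
        (if x = n then ((m + 1).multichoose y : ℚ) else 0) =
          if p = n then ((m + 1 + 1).multichoose q : ℚ) else 0 := by
      split_ifs with hpn
      · rw [Finset.sum_eq_single_of_mem n (Finset.mem_Ico.2 (by omega))]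
        · simp [sum_multichoose]
        · intro x _ hx
          simp [hx]
      · refine Finset.sum_eq_zero fun x hx => Finset.sum_eq_zero fun y _ => if_neg ?_
        rw [Finset.mem_Ico] at hx
        omega
    rw [sum_shifted_pathDet m hq.le, Finset.sum_range_succ' _ m, hk, ht,
      pathDet_zero_left (by omega)]
    ring

theorem sum_stateCount_row {n p : ℕ} (m : ℕ) (hp : p < n) :
    ∑ q ∈ Finset.range (p + 1), stateCount n m (p + 1) q =
      rowSum m (p + 1) + ∑ k ∈ Finset.range m, parallelogramCount k p -
        if p + 1 = n then ((m + 2).multichoose p : ℚ) else 0 := by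
  rw [Finset.sum_congr rfl fun q hq => stateCount_of_lt m (Finset.mem_range.1 hq) hp,
    Finset.sum_sub_distrib, Finset.sum_add_distrib, sum_shifted_pathDet_row, Finset.sum_comm,
    Finset.sum_congr rfl fun k _ => sum_pathDet_row k p, rowSum]
  split_ifs
  · rw [sum_multichoose]
  · simp

theorem sum_rowSum (i m : ℕ) :
    ∑ k ∈ Finset.range m, rowSum i (k + 1) =
      (m + 1) * rowSum i m - ∑ j ∈ Finset.range m, ((j : ℚ) + 1) * parallelogramCount i j := by
  induction m with
  | zero => simp [rowSum]
  | succ m ih =>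
    rw [Finset.sum_range_succ, ih, Finset.sum_range_succ]
    simp only [rowSum, Finset.sum_range_succ _ m]
    push_cast
    ring

theorem stateCount_zero_right {n p : ℕ} (m : ℕ) (hp : p < n) :
    stateCount n m (p + 1) 0 = (m + 1).multichoose (p + 1) - if p + 1 = n then 1 else 0 := by
  rw [stateCount_of_lt m (by omega) (by omega)]
  have h : ∑ k ∈ Finset.range (m + 1), pathDet k (p + 1) 0 = (m + 1).multichoose (p + 1) := by
    have := Finset.sum_range_sub (fun k => (k.multichoose (p + 1) : ℚ)) (m + 1)
    simpa [pathDet] using this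
  rw [Finset.sum_range_succ] at h
  simp
  linarith

theorem sum_stateCount (m : ℕ) :
    ∑ p ∈ Finset.range (m + 1 + 1), ∑ q ∈ Finset.range (m + 1 + 1),
      (if 0 < q then stateCount (m + 1) m p q else 0) = matrixCount m := by
  have h0 : ∑ q ∈ Finset.range (m + 1 + 1),
      (if 0 < q then stateCount (m + 1) m 0 q else 0) = 0 := by
    refine Finset.sum_eq_zero fun q _ => ite_eq_right_iff.2 fun hq =>
      stateCount_of_not_isRowState fun h => ?_
    have := h.1
    omega
  have h1 (p : ℕ) (hp : p ∈ Finset.range (m + 1)) : ∑ q ∈ Finset.range (m + 1 + 1),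
      (if 0 < q then stateCount (m + 1) m (p + 1) q else 0) =
        rowSum m (p + 1) + ∑ k ∈ Finset.range m, parallelogramCount k p -
          (m + 1).multichoose (p + 1) +
        if p = m then 1 - ((m + 2).multichoose m : ℚ) + stateCount (m + 1) m (m + 1) (m + 1)
          else 0 := by
    rw [Finset.mem_range] at hp
    have hdiag : stateCount (m + 1) m (p + 1) (p + 1) =
        if p = m then stateCount (m + 1) m (m + 1) (m + 1) else 0 := by
      split_ifs with h
      · rw [h]
      · refine stateCount_of_not_isRowState fun hs => ?_
        have := hs.2.2 rfl
        omega
    have hsplit : ∑ q ∈ Finset.range (m + 1 + 1),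
        (if 0 < q then stateCount (m + 1) m (p + 1) q else 0) =
          ∑ q ∈ Finset.range (p + 1 + 1),
            (if 0 < q then stateCount (m + 1) m (p + 1) q else 0) := by
      symm
      refine Finset.sum_subset (Finset.range_subset_range.2 (by omega)) fun q _ hq =>
        ite_eq_right_iff.2 fun _ => stateCount_of_not_isRowState fun hs => hq ?_
      have := hs.1
      rw [Finset.mem_range]
      omega
    have hrow := sum_stateCount_row m hp
    rw [Finset.sum_range_succ', stateCount_zero_right m hp] at hrow
    rw [hsplit, Finset.sum_range_succ, Finset.sum_range_succ', hdiag]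
    simp only [Nat.succ_pos, if_true, lt_irrefl, if_false]
    simp only [add_left_inj] at hrow ⊢
    split_ifs at hrow ⊢ with h
    · rw [h] at hrow ⊢
      linarith
    · linarith
  have hmc : ∑ p ∈ Finset.range (m + 1), ((m + 1).multichoose (p + 1) : ℚ) =
      (m + 1).centralBinom - 1 := by
    have h := sum_multichoose (m + 1) (m + 1)
    rw [Finset.sum_range_succ', Nat.multichoose_zero_right, Nat.multichoose_eq (m + 1 + 1),
      show m + 1 + 1 + (m + 1) - 1 = 2 * (m + 1) by omega, ← Nat.centralBinom] at h
    rw [← h]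
    simp
  have hmc' : ∑ k ∈ Finset.range (m + 1), ((k + 2).multichoose m : ℚ) =
      (m + 1).centralBinom - 1 := by
    rw [← hmc]
    refine Finset.sum_congr rfl fun k _ => ?_
    rw [Nat.multichoose_eq, Nat.multichoose_eq, show k + 2 + m - 1 = m + (k + 1) by omega,
      show m + 1 + (k + 1) - 1 = m + (k + 1) by omega, Nat.choose_symm_add]
  have htop : stateCount (m + 1) m (m + 1) (m + 1) = ∑ k ∈ Finset.range m, rowSum k (m + 1) +
      ∑ k ∈ Finset.range m, rowSum m k - ∑ k ∈ Finset.range m, ((k + 2).multichoose m : ℚ) := by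
    rw [stateCount_top, ← Finset.sum_add_distrib, ← Finset.sum_sub_distrib]
    refine Finset.sum_congr rfl fun k _ => ?_
    rw [sum_stateCount_row k (Nat.lt_succ_self m), if_pos rfl,
      Finset.sum_congr rfl fun i _ => parallelogramCount_comm i m, ← rowSum]
  have hsq : ∑ p ∈ Finset.range (m + 1), ∑ k ∈ Finset.range m, parallelogramCount k p =
      ∑ k ∈ Finset.range m, rowSum k (m + 1) := Finset.sum_comm
  have hsq' : squareSum (m + 1) = ∑ k ∈ Finset.range m, rowSum k (m + 1) + rowSum m (m + 1) :=
    Finset.sum_range_succ _ m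
  have hrs := sum_rowSum m (m + 1)
  have hrs' : ∑ k ∈ Finset.range (m + 1), rowSum m (k + 1) = ∑ k ∈ Finset.range m, rowSum m k +
      rowSum m m + rowSum m (m + 1) := by
    rw [← Finset.sum_range_succ, ← Finset.sum_range_succ, Finset.sum_range_succ' _ (m + 1)]
    simp [rowSum]
  have hlast : rowSum m (m + 1) = rowSum m m + parallelogramCount m m :=
    Finset.sum_range_succ _ m
  have hw : 2 * ∑ j ∈ Finset.range (m + 1), ((j : ℚ) + 1) * parallelogramCount m j =
      -m * rowSum m (m + 1) + 2 * (2 * m + 1) * parallelogramCount m m := by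
    have h := weighted_rowSum m m
    rw [← Finset.sum_mul] at h
    apply mul_left_cancel₀ (show (m : ℚ) + 1 ≠ 0 by positivity)
    linear_combination h
  rw [Finset.sum_range_succ' _ (m + 1), h0, Finset.sum_congr rfl h1]
  simp only [Finset.sum_add_distrib, Finset.sum_sub_distrib]
  rw [Finset.sum_ite_eq' (Finset.range (m + 1)) m, if_pos (Finset.self_mem_range_succ m), hmc,
    hsq, htop, matrixCount]
  rw [Finset.sum_range_succ] at hmc'
  push_cast at hrs
  linear_combination (-1) * hmc' - 2 * hsq' + 2 * hrs - hrs' - hw + hlast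

/-- The entry in column `j` of the row of length `n` encoded by `(p, q)`. -/
def rowEntry (n p q j : ℕ) : ℕ :=
  if j + p < n then 0 else if j + q < n then 1 else 2

theorem IsRowState.rowEntry_succ {n p q j : ℕ} (h : IsRowState n p q) (hj : j + 1 < n) :
    rowEntry n p q j ≤ rowEntry n p q (j + 1) ∧
      rowEntry n p q (j + 1) ≤ rowEntry n p q j + 1 := by
  unfold IsRowState at h
  unfold rowEntry
  split_ifs <;> omega

theorem RowStep.rowEntry_below {n p q p' q' j : ℕ} (h : RowStep n p q p' q') :
    rowEntry n p q j ≤ rowEntry n p' q' j ∧ rowEntry n p' q' j ≤ rowEntry n p q j + 1 := by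
  unfold RowStep at h
  unfold rowEntry
  split_ifs <;> omega

theorem RowStep.rowEntry_diagonal {n p q p' q' j : ℕ} (h : RowStep n p q p' q')
    (hj : j + 1 < n) :
    rowEntry n p q j ≤ rowEntry n p' q' (j + 1) ∧
      rowEntry n p' q' (j + 1) ≤ rowEntry n p q j + 1 := by
  unfold RowStep at h
  unfold rowEntry
  split_ifs <;> omega

theorem rowStep_of_rowEntry {n p q p' q' : ℕ} (hs : IsRowState n p q)
    (hs' : IsRowState n p' q')
    (hv : ∀ j < n, rowEntry n p q j ≤ rowEntry n p' q' j ∧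
      rowEntry n p' q' j ≤ rowEntry n p q j + 1)
    (hd : ∀ j, j + 1 < n → rowEntry n p' q' (j + 1) ≤ rowEntry n p q j + 1) :
    RowStep n p q p' q' := by
  unfold IsRowState at hs hs'
  unfold rowEntry at hv hd
  have hq : q' ≤ p := by
    by_contra h
    have := hv (n - q') (by omega)
    split_ifs at this <;> omega
  refine ⟨?_, ?_, hq, ?_⟩
  · by_contra h
    have := hv (n - p) (by omega)
    split_ifs at this <;> omega
  · by_contra h
    have := hv (n - q) (by omega)
    split_ifs at this <;> omega
  · by_contra h
    have := hd (n - q' - 1) (by omega)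
    split_ifs at this <;> omega

theorem rowEntry_injective {n p q p' q' : ℕ} (hs : IsRowState n p q)
    (hs' : IsRowState n p' q') (h : ∀ j < n, rowEntry n p q j = rowEntry n p' q' j) :
    p = p' ∧ q = q' := by
  unfold IsRowState at hs hs'
  unfold rowEntry at h
  constructor
  · by_contra hne
    rcases Nat.lt_or_gt_of_ne hne with hlt | hlt
    · have := h (n - p') (by omega)
      split_ifs at this <;> omega
    · have := h (n - p) (by omega)
      split_ifs at this <;> omega
  · by_contra hne
    rcases Nat.lt_or_gt_of_ne hne with hlt | hlt
    · have := h (n - q') (by omega)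
      split_ifs at this <;> omega
    · have := h (n - q) (by omega)
      split_ifs at this <;> omega

theorem exists_threshold (n : ℕ) (P : ℕ → Prop) (h : ∀ j, j + 1 < n → P j → P (j + 1)) :
    ∃ p ≤ n, ∀ j < n, P j ↔ n ≤ j + p := by
  induction n with
  | zero => exact ⟨0, le_rfl, by simp⟩
  | succ n ih =>
    obtain ⟨p, hp, hP⟩ := ih fun j hj => h j (by omega)
    by_cases hn : P n
    · refine ⟨p + 1, by omega, fun j hj => ?_⟩
      rcases Nat.lt_succ_iff_lt_or_eq.1 hj with hj | rfl
      · rw [hP j hj]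
        omega
      · simp only [hn, true_iff]
        omega
    · refine ⟨0, by omega, fun j hj => ?_⟩
      rcases Nat.lt_succ_iff_lt_or_eq.1 hj with hj | rfl
      · have hp0 : p = 0 := by
          by_contra hp0
          refine hn ?_
          have := h (n - 1) (by omega) ((hP (n - 1) (by omega)).2 (by omega))
          rwa [show n - 1 + 1 = n by omega] at this
        rw [hP j hj]
        omega
      · simp [hn]

theorem exists_rowState {n : ℕ} {r : ℕ → ℕ} (hle : ∀ j < n, r j ≤ 2)
    (hr : ∀ j, j + 1 < n → r j ≤ r (j + 1) ∧ r (j + 1) ≤ r j + 1) :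
    ∃ p q, IsRowState n p q ∧ ∀ j < n, r j = rowEntry n p q j := by
  obtain ⟨p, hp, hP⟩ := exists_threshold n (fun j => 1 ≤ r j) fun j hj h => h.trans (hr j hj).1
  obtain ⟨q, hq, hQ⟩ := exists_threshold n (fun j => 2 ≤ r j) fun j hj h => h.trans (hr j hj).1
  refine ⟨p, q, ⟨?_, hp, ?_⟩, fun j hj => ?_⟩
  · by_contra hqp
    have h1 := hP (n - q) (by omega)
    have h2 := hQ (n - q) (by omega)
    omega
  · rintro rfl
    by_contra hne
    have h1 := hP (n - p - 1) (by omega)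
    have h2 := hQ (n - p) (by omega)
    have h3 := hr (n - p - 1) (by omega)
    rw [show n - p - 1 + 1 = n - p by omega] at h3
    omega
  · have h1 := hP j hj
    have h2 := hQ j hj
    have h3 := hle j hj
    unfold rowEntry
    split_ifs <;> omega

theorem sum_chain {S : Type*} [Fintype S] (r : S → S → ℚ) (W : ℕ → S → ℚ)
    (hW : ∀ m t, W (m + 1) t = ∑ s, W m s * r s t) (m : ℕ) (ε : S → ℚ) :
    ∑ f : Fin (m + 1) → S,
        W 0 (f 0) * (∏ i : Fin m, r (f i.castSucc) (f i.succ)) * ε (f (Fin.last m)) =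
      ∑ s, W m s * ε s := by
  induction m generalizing ε with
  | zero =>
    rw [← (Equiv.funUnique (Fin 1) S).symm.sum_comp]
    simp
  | succ m ih =>
    rw [← (Fin.snocEquiv fun _ : Fin (m + 2) => S).sum_comp, Fintype.sum_prod_type]
    refine Finset.sum_congr rfl fun t _ => ?_
    rw [hW, Finset.sum_mul]
    have h := ih fun s => r s t * ε t
    simp only [← mul_assoc] at h
    rw [← h]
    refine Finset.sum_congr rfl fun g _ => ?_
    rw [Fin.prod_univ_castSucc]
    have h0 : (Fin.snocEquiv fun _ : Fin (m + 2) => S) (t, g) 0 = g 0 :=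
      Fin.snoc_castSucc (α := fun _ => S) t g 0
    have hlast : (Fin.snocEquiv fun _ : Fin (m + 2) => S) (t, g) (Fin.last (m + 1)) = t :=
      Fin.snoc_last (α := fun _ => S) t g
    have hc (i : Fin (m + 1)) :
        (Fin.snocEquiv fun _ : Fin (m + 2) => S) (t, g) i.castSucc = g i :=
      Fin.snoc_castSucc (α := fun _ => S) t g i
    simp only [h0, hlast, hc, Fin.succ_last, Fin.succ_castSucc]
    ring

/-- A sequence of encoded rows that describes an `(m + 1) × (m + 1)` matrix counted by
`a306322`. -/
def IsStateChain (m : ℕ) (f : Fin (m + 1) → Fin (m + 2) × Fin (m + 2)) : Prop :=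
  (IsRowState (m + 1) (f 0).1 (f 0).2 ∧ ((f 0).1 : ℕ) < m + 1) ∧
    (∀ i : Fin m, RowStep (m + 1) (f i.castSucc).1 (f i.castSucc).2 (f i.succ).1 (f i.succ).2 ∧
      IsRowState (m + 1) (f i.succ).1 (f i.succ).2) ∧
    0 < ((f (Fin.last m)).2 : ℕ)

theorem IsStateChain.isRowState {m : ℕ} {f : Fin (m + 1) → Fin (m + 2) × Fin (m + 2)}
    (hf : IsStateChain m f) (i : Fin (m + 1)) : IsRowState (m + 1) (f i).1 (f i).2 := by
  cases i using Fin.cases with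
  | zero => exact hf.1.1
  | succ i => exact (hf.2.1 i).2

theorem card_isStateChain (m : ℕ) :
    (Nat.card {f // IsStateChain m f} : ℚ) =
      ∑ p ∈ Finset.range (m + 1 + 1), ∑ q ∈ Finset.range (m + 1 + 1),
        if 0 < q then stateCount (m + 1) m p q else 0 := by
  classical
  have h := sum_chain (S := Fin (m + 2) × Fin (m + 2))
    (fun s t => if RowStep (m + 1) s.1 s.2 t.1 t.2 ∧ IsRowState (m + 1) t.1 t.2 then 1 else 0)
    (fun k s => stateCount (m + 1) k s.1 s.2)
    (fun k t => by
      rw [stateCount, Fintype.sum_prod_type, Finset.sum_range]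
      refine Finset.sum_congr rfl fun p _ => ?_
      rw [Finset.sum_range]
      simp) m (fun s => if 0 < (s.2 : ℕ) then 1 else 0)
  rw [Fintype.sum_prod_type (f := fun s : Fin (m + 2) × Fin (m + 2) =>
    stateCount (m + 1) m s.1 s.2 * if 0 < (s.2 : ℕ) then 1 else 0)] at h
  rw [Finset.sum_range]
  simp only [Finset.sum_range, mul_ite, mul_one, mul_zero] at h ⊢
  rw [← h, Nat.card_eq_fintype_card, Fintype.card_subtype, Finset.card_filter]
  push_cast
  refine Finset.sum_congr rfl fun f _ => ?_
  rw [Fintype.prod_boole, stateCount]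
  unfold IsStateChain
  split_ifs <;> first | tauto | simp

/-- The matrix whose rows are encoded by `f`. -/
def stateMatrix (m : ℕ) (f : Fin (m + 1) → Fin (m + 2) × Fin (m + 2)) :
    Fin (m + 1) × Fin (m + 1) → ℕ :=
  fun x => rowEntry (m + 1) (f x.1).1 (f x.1).2 x.2

theorem card_isStateChain_eq_a306322 (m : ℕ) :
    a306322 (m + 1) = Nat.card {f // IsStateChain m f} := by
  symm
  refine Nat.card_congr (Equiv.ofBijective (fun f => ⟨stateMatrix m f.1, ?_, ?_, ?_⟩) ⟨?_, ?_⟩)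
  · rintro ⟨i, j⟩ hi hj
    obtain rfl : i = 0 := Fin.ext hi
    have h := f.2.1.2
    simp only [stateMatrix, rowEntry]
    simp only at hj
    rw [if_pos (by omega)]
  · rintro ⟨i, j⟩ hi hj
    obtain rfl : i = Fin.last m := Fin.ext hi
    have h := f.2.2.2
    have h' := (f.2.isRowState (Fin.last m)).1
    simp only [stateMatrix, rowEntry]
    simp only at hj
    rw [if_neg (by omega), if_neg (by omega)]
  · rintro ⟨i, j⟩ ⟨i', j'⟩ h
    simp only [stateMatrix]
    simp only at h
    have hstep (h : (i' : ℕ) = i + 1) :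
        RowStep (m + 1) (f.1 i).1 (f.1 i).2 (f.1 i').1 (f.1 i').2 := by
      have := (f.2.2.1 ⟨i, by omega⟩).1
      rwa [show (⟨i, by omega⟩ : Fin m).castSucc = i from rfl,
        show (⟨i, by omega⟩ : Fin m).succ = i' from Fin.ext h.symm] at this
    rcases h with ⟨rfl, h⟩ | ⟨h, rfl⟩ | ⟨h, h'⟩
    · rw [h]
      exact (f.2.isRowState _).rowEntry_succ (by omega)
    · exact (hstep h).rowEntry_below
    · rw [h']
      exact (hstep h).rowEntry_diagonal (by omega)
  · rintro ⟨f, hf⟩ ⟨g, hg⟩ h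
    rw [Subtype.mk.injEq] at h ⊢
    funext i
    have hi := rowEntry_injective (hf.isRowState i) (hg.isRowState i) fun j hj =>
      congrFun h (i, ⟨j, hj⟩)
    exact Prod.ext (Fin.ext hi.1) (Fin.ext hi.2)
  · rintro ⟨M, h0, h2, hM⟩
    have hle (i j : Fin (m + 1)) : M (i, j) ≤ 2 := by
      rw [← h2 (Fin.last m, Fin.last m) rfl rfl]
      have hrow : Monotone fun j => M (i, j) :=
        Fin.monotone_iff_le_succ.2 fun j => (hM (i, j.castSucc) (i, j.succ) (Or.inl ⟨rfl, by simp⟩)).1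
      have hcol : Monotone fun i => M (i, Fin.last m) :=
        Fin.monotone_iff_le_succ.2 fun i =>
          (hM (i.castSucc, Fin.last m) (i.succ, Fin.last m) (Or.inr (Or.inl ⟨by simp, rfl⟩))).1
      exact (hrow (Fin.le_last j)).trans (hcol (Fin.le_last i))
    have hrow (i : Fin (m + 1)) : ∃ s : Fin (m + 2) × Fin (m + 2),
        IsRowState (m + 1) s.1 s.2 ∧
          ∀ j : Fin (m + 1), M (i, j) = rowEntry (m + 1) s.1 s.2 j := by
      obtain ⟨p, q, hs, hr⟩ := exists_rowState (n := m + 1)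
        (r := fun j => if h : j < m + 1 then M (i, ⟨j, h⟩) else 0)
        (fun j hj => by simpa [hj] using hle _ _)
        (fun j hj => by
          simp only [hj, show j < m + 1 by omega, dif_pos]
          exact hM _ _ (Or.inl ⟨rfl, rfl⟩))
      have := hs.1
      have := hs.2.1
      refine ⟨(⟨p, by omega⟩, ⟨q, by omega⟩), hs, fun j => ?_⟩
      simpa [j.2] using hr j j.2
    choose f hf hfM using hrow
    refine ⟨⟨f, ⟨hf 0, ?_⟩, fun i => ⟨?_, hf _⟩, ?_⟩,
      Subtype.ext (funext fun x => (hfM _ _).symm)⟩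
    · have h := h0 (0, 0) rfl rfl
      rw [hfM] at h
      unfold rowEntry at h
      split_ifs at h
      simp at *
      omega
    · refine rowStep_of_rowEntry (hf _) (hf _) (fun j hj => ?_) fun j hj => ?_
      · have h := hM (i.castSucc, ⟨j, hj⟩) (i.succ, ⟨j, hj⟩) (Or.inr (Or.inl ⟨by simp, rfl⟩))
        rwa [hfM, hfM] at h
      · have h := hM (i.castSucc, ⟨j, by omega⟩) (i.succ, ⟨j + 1, hj⟩)
          (Or.inr (Or.inr ⟨by simp, rfl⟩))
        rw [hfM, hfM] at h
        exact h.2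
    · have h := h2 (Fin.last m, Fin.last m) rfl rfl
      rw [hfM] at h
      unfold rowEntry at h
      split_ifs at h
      simp at *
      omega

theorem a306322_succ (m : ℕ) : (a306322 (m + 1) : ℚ) = matrixCount m := by
  rw [card_isStateChain_eq_a306322, card_isStateChain, sum_stateCount]

/-- There are polynomials `p₀, …, p₄ ∈ ℤ[x]`, each of degree at most `14` and
with `p₄ ≠ 0`, such that `p₀(n)·a(n) + ⋯ + p₄(n)·a(n+4) = 0` for all `n ≥ 1`;
in particular `a306322` is D-finite. -/
theorem stmt17 :
    ∃ p : Fin 5 → Polynomial ℤ,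
      (∀ i, (p i).degree ≤ 14) ∧ p 4 ≠ 0 ∧
      ∀ n : ℕ, 1 ≤ n →
        ∑ i : Fin 5, (p i).eval (n : ℤ) * (a306322 (n + (i : ℕ)) : ℤ) = 0 := by
  refine ⟨![recCoeff₀ Polynomial.X, recCoeff₁ Polynomial.X, recCoeff₂ Polynomial.X,
    recCoeff₃ Polynomial.X, recCoeff₄ Polynomial.X], fun i => ?_, fun h => ?_, fun n hn => ?_⟩
  · fin_cases i
    · change (recCoeff₀ Polynomial.X : Polynomial ℤ).degree ≤ 14
      unfold recCoeff₀
      compute_degree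
    · change (recCoeff₁ Polynomial.X : Polynomial ℤ).degree ≤ 14
      unfold recCoeff₁
      compute_degree
    · change (recCoeff₂ Polynomial.X : Polynomial ℤ).degree ≤ 14
      unfold recCoeff₂
      compute_degree
    · change (recCoeff₃ Polynomial.X : Polynomial ℤ).degree ≤ 14
      unfold recCoeff₃
      compute_degree
    · change (recCoeff₄ Polynomial.X : Polynomial ℤ).degree ≤ 14
      unfold recCoeff₄
      compute_degree
  · have h0 := congrArg (Polynomial.eval 0) h
    simp [recCoeff₄] at h0
  · obtain ⟨m, rfl⟩ := Nat.exists_eq_add_of_le' hn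
    have h := matrixCount_recurrence m
    rw [← a306322_succ, ← a306322_succ, ← a306322_succ, ← a306322_succ, ← a306322_succ] at h
    have e (k : ℕ) : m + 1 + k = m + k + 1 := by ring
    rw [← Int.cast_inj (α := ℚ), Fin.sum_univ_five]
    simp only [recCoeff₀, recCoeff₁, recCoeff₂, recCoeff₃, recCoeff₄] at h ⊢
    simp [e]
    linear_combination h
end
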